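/- Let M ≥ 1 be an integer and for each l ∈ {1,…,M} let ν_l > 0, α_{1l} ∈ (0,1], α_{2l} ∈ (0,1], and c_{l1} > 0 be real numbers; let ε > 0 and δ > 0. Let j be a natural number and m a nonzero integer with 2^j ≤ |m| ≤ 2^{j+2}. For each l let g_l ∈ ℂ satisfy |g_l|² ≥ c_{l1}|m|^{-2ν_l}, and set ω_l = (ε^{2α_{1l}}|m|^{α_{1l}-1} + δ^{2α_{2l}}|m|^{α_{2l}-1})^{-1}. Then (∑_{l=1}^M ω_l |g_l|²)^{-1} ≤ (1/M²) ∑_{l=1}^M (16^{ν_l}/c_{l1}) (ε^{2α_{1l}} 2^{j(2ν_l+α_{1l}-1)} + δ^{2α_{2l}} 2^{j(2ν_l+α_{2l}-1)}). -/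

import Mathlib

/-- The harmonic mean of a positive family is at most its arithmetic mean, in the form of a bound
on `(∑ a)⁻¹` for a family `a` dominating the inverses of `b`. -/
theorem inv_sum_le_of_inv_le {ι : Type*} [Fintype ι] [Nonempty ι] {a b : ι → ℝ}
    (hb : ∀ i, 0 < b i) (hab : ∀ i, (b i)⁻¹ ≤ a i) :
    (∑ i, a i)⁻¹ ≤ 1 / (Fintype.card ι : ℝ) ^ 2 * ∑ i, b i := by
  have hB : 0 < ∑ i, b i := Finset.sum_pos (fun i _ => hb i) Finset.univ_nonempty
  have hsum : (Fintype.card ι : ℝ) ^ 2 / ∑ i, b i ≤ ∑ i, a i := by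
    have h := Finset.sq_sum_div_le_sum_sq_div Finset.univ (fun _ : ι => (1 : ℝ))
      (fun i _ => hb i)
    simp only [Finset.sum_const, Finset.card_univ, nsmul_eq_mul, mul_one, one_pow, one_div] at h
    exact h.trans (Finset.sum_le_sum fun i _ => hab i)
  have hcard : (0 : ℝ) < Fintype.card ι := by exact_mod_cast Fintype.card_pos
  calc (∑ i, a i)⁻¹ ≤ ((Fintype.card ι : ℝ) ^ 2 / ∑ i, b i)⁻¹ := by gcongr
    _ = 1 / (Fintype.card ι : ℝ) ^ 2 * ∑ i, b i := by rw [inv_div]; ring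

/-- On the dyadic band `2 ^ j ≤ x ≤ 2 ^ (j + 2)`, a product of a nonnegative and a nonpositive
power of `x` is controlled by the same powers of `2 ^ j`. -/
theorem rpow_mul_rpow_le_of_dyadic_band {x ν α : ℝ} {j : ℕ} (hν : 0 ≤ ν) (hα : α ≤ 1)
    (h1 : (2 : ℝ) ^ j ≤ x) (h2 : x ≤ (2 : ℝ) ^ (j + 2)) :
    x ^ (2 * ν) * x ^ (α - 1) ≤ (16 : ℝ) ^ ν * (2 : ℝ) ^ ((j : ℝ) * (2 * ν + α - 1)) := by
  have hx : 0 < x := lt_of_lt_of_le (by positivity) h1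
  have hp : x ^ (2 * ν) ≤ (16 : ℝ) ^ ν * (2 : ℝ) ^ ((j : ℝ) * (2 * ν)) := by
    have h16 : (16 : ℝ) ^ ν = (2 : ℝ) ^ (4 * ν) := by
      rw [Real.rpow_mul (by norm_num)]; norm_num
    calc x ^ (2 * ν) ≤ ((2 : ℝ) ^ (j + 2)) ^ (2 * ν) :=
          Real.rpow_le_rpow hx.le h2 (by positivity)
      _ = (16 : ℝ) ^ ν * (2 : ℝ) ^ ((j : ℝ) * (2 * ν)) := by
          rw [h16, ← Real.rpow_natCast, ← Real.rpow_mul (by norm_num),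
            ← Real.rpow_add (by norm_num)]
          push_cast
          ring_nf
  have hn : x ^ (α - 1) ≤ (2 : ℝ) ^ ((j : ℝ) * (α - 1)) := by
    rw [Real.rpow_mul (by norm_num), Real.rpow_natCast]
    exact Real.rpow_le_rpow_of_nonpos (by positivity) h1 (by linarith)
  calc x ^ (2 * ν) * x ^ (α - 1)
      ≤ ((16 : ℝ) ^ ν * (2 : ℝ) ^ ((j : ℝ) * (2 * ν))) * (2 : ℝ) ^ ((j : ℝ) * (α - 1)) := by
        gcongr
    _ = (16 : ℝ) ^ ν * (2 : ℝ) ^ ((j : ℝ) * (2 * ν + α - 1)) := by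
        rw [mul_assoc, ← Real.rpow_add (by norm_num)]
        ring_nf


/-- The deterministic upper-bound core of Lemma 1: with the optimal weights
`ω l = (ε^{2α₁l}|m|^{α₁l-1} + δ^{2α₂l}|m|^{α₂l-1})⁻¹` and the lower kernel
bound of Assumption 1, the per-frequency variance factor `(∑ ω |g|²)⁻¹` is
bounded by the arithmetic mean of the channel-wise rates. -/
theorem stmt3 (M : ℕ) (hM : 1 ≤ M)
    (ν α₁ α₂ c₁ : Fin M → ℝ)
    (hν : ∀ l, 0 < ν l)
    (hα₁ : ∀ l, 0 < α₁ l ∧ α₁ l ≤ 1) (hα₂ : ∀ l, 0 < α₂ l ∧ α₂ l ≤ 1)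
    (hc₁ : ∀ l, 0 < c₁ l)
    (ε δ : ℝ) (hε : 0 < ε) (hδ : 0 < δ)
    (j : ℕ) (m : ℤ) (hm : m ≠ 0)
    (hm1 : (2:ℤ)^j ≤ |m|) (hm2 : |m| ≤ (2:ℤ)^(j+2))
    (g : Fin M → ℂ)
    (hg : ∀ l, c₁ l * |(m:ℝ)| ^ (-(2 * ν l)) ≤ ‖g l‖^2)
    (ω : Fin M → ℝ)
    (hω : ∀ l, ω l = (ε ^ (2 * α₁ l) * |(m:ℝ)| ^ (α₁ l - 1)
                      + δ ^ (2 * α₂ l) * |(m:ℝ)| ^ (α₂ l - 1))⁻¹) :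
    (∑ l, ω l * ‖g l‖^2)⁻¹
      ≤ (1/(M:ℝ)^2) * ∑ l, ((16:ℝ) ^ (ν l) / c₁ l) *
          (ε ^ (2 * α₁ l) * (2:ℝ) ^ ((j:ℝ)*(2*ν l + α₁ l - 1))
           + δ ^ (2 * α₂ l) * (2:ℝ) ^ ((j:ℝ)*(2*ν l + α₂ l - 1))) := by
  have hx1 : (2 : ℝ) ^ j ≤ |(m : ℝ)| := by exact_mod_cast hm1
  have hx2 : |(m : ℝ)| ≤ (2 : ℝ) ^ (j + 2) := by exact_mod_cast hm2
  have hx : 0 < |(m : ℝ)| := by positivity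
  have : Nonempty (Fin M) := ⟨⟨0, hM⟩⟩
  have hpos : ∀ l, 0 < ((16 : ℝ) ^ (ν l) / c₁ l) *
      (ε ^ (2 * α₁ l) * (2 : ℝ) ^ ((j : ℝ) * (2 * ν l + α₁ l - 1))
        + δ ^ (2 * α₂ l) * (2 : ℝ) ^ ((j : ℝ) * (2 * ν l + α₂ l - 1))) := fun l => by
    have := hc₁ l
    positivity
  refine (inv_sum_le_of_inv_le hpos fun l => ?_).trans_eq (by rw [Fintype.card_fin])
  have hc := hc₁ l
  have hb₁ := rpow_mul_rpow_le_of_dyadic_band (hν l).le (hα₁ l).2 hx1 hx2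
  have hb₂ := rpow_mul_rpow_le_of_dyadic_band (hν l).le (hα₂ l).2 hx1 hx2
  set S := ε ^ (2 * α₁ l) * |(m : ℝ)| ^ (α₁ l - 1) + δ ^ (2 * α₂ l) * |(m : ℝ)| ^ (α₂ l - 1)
    with hS
  have hS0 : 0 < S := by positivity
  have hrate : S * |(m : ℝ)| ^ (2 * ν l) / c₁ l ≤ ((16 : ℝ) ^ (ν l) / c₁ l) *
      (ε ^ (2 * α₁ l) * (2 : ℝ) ^ ((j : ℝ) * (2 * ν l + α₁ l - 1))
        + δ ^ (2 * α₂ l) * (2 : ℝ) ^ ((j : ℝ) * (2 * ν l + α₂ l - 1))) := by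
    rw [div_mul_eq_mul_div]
    refine div_le_div_of_nonneg_right ?_ hc.le
    have h₁ := mul_le_mul_of_nonneg_left hb₁ (by positivity : 0 ≤ ε ^ (2 * α₁ l))
    have h₂ := mul_le_mul_of_nonneg_left hb₂ (by positivity : 0 ≤ δ ^ (2 * α₂ l))
    rw [hS]
    linarith
  calc _ ≤ (S * |(m : ℝ)| ^ (2 * ν l) / c₁ l)⁻¹ := inv_anti₀ (by positivity) hrate
    _ = S⁻¹ * (c₁ l * |(m : ℝ)| ^ (-(2 * ν l))) := by
        rw [Real.rpow_neg hx.le, inv_div, div_eq_mul_inv, mul_inv]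
        ring
    _ ≤ ω l * ‖g l‖ ^ 2 := by
        rw [hω l]
        exact mul_le_mul_of_nonneg_left (hg l) (by positivity)
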